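/- arXiv:1510.08331 — 4 statements merged into one kernel-verified Lean document; each statement's English description precedes it below -/
import Mathlib

section
/- Let T be a Petri net of dimension d and define prop_T(I) = ⋃ {pos(v) : (u,v) ∈ T, pos(u) ⊆ I} for sets I of indices in {1,…,d}. Then I₊(T) is the least fixed point of prop_T with respect to inclusion: prop_T(I₊(T)) = I₊(T), and every set I with prop_T(I) = I satisfies I₊(T) ⊆ I. -/
/-- A configuration of dimension `d` is a vector in `ℕ^d`. -/
abbrev Config (d : ℕ) := Fin d → ℕ

/-- A transition is a pair `(u, v)` of configurations. -/
abbrev Transition (d : ℕ) := Config d × Config d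

/-- `x →t y` iff there exists `z` with `x = u + z` and `y = v + z` where `t = (u, v)`. -/
def Step {d : ℕ} (t : Transition d) (x y : Config d) : Prop :=
  ∃ z : Config d, x = t.1 + z ∧ y = t.2 + z

/-- `x →w y` for a word `w = t₁…t_k` of transitions. -/
def Fire {d : ℕ} : List (Transition d) → Config d → Config d → Prop
  | [], x, y => x = y
  | t :: w, x, y => ∃ c, Step t x c ∧ Fire w c y

/-- `x →T* y`: reachability via a word over `T`. -/
def ReachStar {d : ℕ} (T : Finset (Transition d)) (x y : Config d) : Prop :=
  ∃ w : List (Transition d), (∀ t ∈ w, t ∈ T) ∧ Fire w x y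

/-- `x →T+ y`: reachability via a nonempty word over `T`. -/
def ReachPlus {d : ℕ} (T : Finset (Transition d)) (x y : Config d) : Prop :=
  ∃ w : List (Transition d), w ≠ [] ∧ (∀ t ∈ w, t ∈ T) ∧ Fire w x y

/-- A configuration `c` is cyclic for `T` if `c →T+ c`. -/
def Cyclic {d : ℕ} (T : Finset (Transition d)) (c : Config d) : Prop :=
  ReachPlus T c c

/-- `T` is structurally cyclic if every configuration is cyclic for `T`. -/
def StructurallyCyclic {d : ℕ} (T : Finset (Transition d)) : Prop :=
  ∀ c : Config d, Cyclic T c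

/-- `pos c` is the set of indices where `c` is positive. -/
def pos {d : ℕ} (c : Config d) : Set (Fin d) := {i | 0 < c i}

/-- `I₊(T)`: the forward markable indices. -/
def Iplus {d : ℕ} (T : Finset (Transition d)) : Set (Fin d) :=
  {i | ∃ c : Config d, ReachStar T 0 c ∧ i ∈ pos c}

/-- `I₋(T)`: the backward markable indices. -/
def Iminus {d : ℕ} (T : Finset (Transition d)) : Set (Fin d) :=
  {i | ∃ c : Config d, ReachStar T c 0 ∧ i ∈ pos c}

/-- `I(T) = I₊(T) ∩ I₋(T)`. -/
def Iboth {d : ℕ} (T : Finset (Transition d)) : Set (Fin d) :=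
  Iplus T ∩ Iminus T

/-- `M(T)`: the mutually fireable transitions of `T`. -/
def MSet {d : ℕ} (T : Finset (Transition d)) : Set (Transition d) :=
  {t | t ∈ T ∧ pos t.1 ∪ pos t.2 ⊆ Iboth T}

/-- `U(T)`: the ultimately cyclic transitions of `T`. -/
def USet {d : ℕ} (T : Finset (Transition d)) : Set (Transition d) :=
  {t | ∃ (w : List (Transition d)) (c : Config d),
        (∀ s ∈ w, s ∈ T) ∧ t ∈ w ∧ Fire w c c}

/-- `Λ(T)`: the transitions occurring in a nonempty word `w` with `0 →w 0`. -/
def LambdaSet {d : ℕ} (T : Finset (Transition d)) : Set (Transition d) :=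
  {t | ∃ w : List (Transition d),
        (∀ s ∈ w, s ∈ T) ∧ t ∈ w ∧ Fire w (0 : Config d) (0 : Config d)}

/-- The displacement `Δ(t) = v - u ∈ ℤ^d` of a transition `t = (u, v)`. -/
def Delta {d : ℕ} (t : Transition d) : Fin d → ℤ :=
  fun i => (t.2 i : ℤ) - (t.1 i : ℤ)

/-- The propagation map `prop_T`. -/
def propMap {d : ℕ} (T : Finset (Transition d)) (I : Set (Fin d)) : Set (Fin d) :=
  {i | ∃ t ∈ T, pos t.1 ⊆ I ∧ i ∈ pos t.2}

/-- A Petri net is lossy if it contains the transition `(e_i, 0)` for every index `i`. -/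
def Lossy {d : ℕ} (T : Finset (Transition d)) : Prop :=
  ∀ i : Fin d, ((Pi.single i 1 : Config d), (0 : Config d)) ∈ T

theorem Fire.add_right {d : ℕ} (z : Config d) : ∀ (w : List (Transition d)) (x y : Config d),
    Fire w x y → Fire w (x + z) (y + z)
  | [], x, y, h => by
      have h : x = y := h
      subst h
      rfl
  | t :: w, x, y, h => by
      obtain ⟨c, ⟨z', h1, h2⟩, hf⟩ := h
      exact ⟨c + z, ⟨z' + z, by rw [h1, add_assoc], by rw [h2, add_assoc]⟩,
        Fire.add_right z w c y hf⟩

theorem Fire.append {d : ℕ} : ∀ (w w' : List (Transition d)) (x y z : Config d),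
    Fire w x y → Fire w' y z → Fire (w ++ w') x z
  | [], w', x, y, z, h, h' => by
      have h : x = y := h
      subst h
      exact h'
  | t :: w, w', x, y, z, h, h' => by
      obtain ⟨c, hs, hf⟩ := h
      exact ⟨c, hs, Fire.append w w' c y z hf h'⟩

theorem ReachStar.trans' {d : ℕ} {T : Finset (Transition d)} {x y z : Config d}
    (h : ReachStar T x y) (h' : ReachStar T y z) : ReachStar T x z := by
  obtain ⟨w, hw, hf⟩ := h
  obtain ⟨w', hw', hf'⟩ := h'
  refine ⟨w ++ w', ?_, Fire.append w w' x y z hf hf'⟩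
  intro t ht
  rcases List.mem_append.1 ht with h | h
  · exact hw t h
  · exact hw' t h

theorem ReachStar.zero_add' {d : ℕ} {T : Finset (Transition d)} {a b : Config d}
    (h : ReachStar T 0 a) (h' : ReachStar T 0 b) : ReachStar T 0 (a + b) := by
  refine ReachStar.trans' h' ?_
  obtain ⟨w, hw, hf⟩ := h
  have := Fire.add_right b w 0 a hf
  rw [zero_add] at this
  exact ⟨w, hw, this⟩

theorem ReachStar.zero_nsmul' {d : ℕ} {T : Finset (Transition d)} {a : Config d}
    (h : ReachStar T 0 a) (n : ℕ) : ReachStar T 0 (n • a) := by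
  induction n with
  | zero => rw [zero_smul]; exact ⟨[], by simp, rfl⟩
  | succ n ih => rw [succ_nsmul]; exact ih.zero_add' h

theorem Iplus_cover {d : ℕ} (T : Finset (Transition d)) (u : Config d)
    (hu : pos u ⊆ Iplus T) : ∃ z, ReachStar T 0 (u + z) := by
  have h0 : ReachStar T 0 0 := ⟨[], by simp, rfl⟩
  have key : ∀ i, ∃ c : Config d, ReachStar T 0 c ∧ u i ≤ c i := by
    intro i
    by_cases hi : 0 < u i
    · obtain ⟨c, hc, hp⟩ := hu hi
      refine ⟨u i • c, hc.zero_nsmul' _, ?_⟩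
      have hp : 0 < c i := hp
      simpa using Nat.le_mul_of_pos_right (u i) hp
    · exact ⟨0, h0, by omega⟩
  choose c hc hle using key
  have hs : ReachStar T 0 (∑ i, c i) :=
    Finset.sum_induction c (ReachStar T 0) (fun _ _ => ReachStar.zero_add') h0 (fun i _ => hc i)
  have hle' : u ≤ ∑ i, c i := by
    intro i
    rw [Finset.sum_apply]
    exact (hle i).trans
      (Finset.single_le_sum (f := fun j => c j i) (fun _ _ => Nat.zero_le _) (Finset.mem_univ i))
  obtain ⟨z, hz⟩ := exists_add_of_le hle'
  exact ⟨z, hz ▸ hs⟩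

theorem Fire.pos_subset {d : ℕ} {T : Finset (Transition d)} {I : Set (Fin d)}
    (hI : propMap T I ⊆ I) : ∀ (w : List (Transition d)) (x y : Config d),
    (∀ t ∈ w, t ∈ T) → Fire w x y → pos x ⊆ I → pos y ⊆ I
  | [], x, y, _, h, hx => by
      have h : x = y := h
      exact h ▸ hx
  | t :: w, x, y, hw, h, hx => by
      obtain ⟨c, ⟨z, h1, h2⟩, hf⟩ := h
      refine Fire.pos_subset hI w c y (fun s hs => hw s (List.mem_cons_of_mem _ hs)) hf ?_
      subst h1 h2
      intro i hi
      have hi : 0 < t.2 i + z i := hi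
      by_cases hz : 0 < z i
      · exact hx (show 0 < t.1 i + z i by omega)
      · refine hI ⟨t, hw t List.mem_cons_self, fun j hj => hx ?_, show 0 < t.2 i by omega⟩
        have hj : 0 < t.1 j := hj
        exact (show 0 < t.1 j + z j by omega)

theorem Iplus_subset {d : ℕ} (T : Finset (Transition d)) (I : Set (Fin d))
    (hI : propMap T I ⊆ I) : Iplus T ⊆ I := by
  rintro i ⟨c, ⟨w, hw, hf⟩, hi⟩
  exact Fire.pos_subset hI w 0 c hw hf (fun j hj => absurd hj (lt_irrefl 0)) hi

theorem propMap_mono {d : ℕ} (T : Finset (Transition d)) {I J : Set (Fin d)} (h : I ⊆ J) :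
    propMap T I ⊆ propMap T J := by
  rintro i ⟨t, ht, hp, hi⟩
  exact ⟨t, ht, hp.trans h, hi⟩

theorem propMap_Iplus {d : ℕ} (T : Finset (Transition d)) : propMap T (Iplus T) ⊆ Iplus T := by
  rintro i ⟨t, ht, hp, hi⟩
  obtain ⟨z, hz⟩ := Iplus_cover T t.1 hp
  have hi : 0 < t.2 i := hi
  refine ⟨t.2 + z, hz.trans' ⟨[t], by simpa using ht, t.2 + z, ⟨z, rfl, rfl⟩, rfl⟩, ?_⟩
  exact (show 0 < t.2 i + z i by omega)

/-- `I₊(T)` is the least fixed point of `prop_T` with respect to inclusion. -/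
theorem Iplus_least_fixed_point {d : ℕ} (T : Finset (Transition d)) :
    propMap T (Iplus T) = Iplus T ∧
      ∀ I : Set (Fin d), propMap T I = I → Iplus T ⊆ I := by
  exact ⟨(propMap_Iplus T).antisymm (Iplus_subset T _ (propMap_mono T (propMap_Iplus T))),
    fun I hI => Iplus_subset T I hI.subset⟩
end

section
/- Let T be a Petri net of dimension d in which every transition is mutually fireable, i.e., M(T) = T. Then there exist configurations x, y ∈ ℕ^d such that pos(x) = I(T) = pos(y), and such that y →T* 0 and 0 →T* x. -/
theorem fire_add_right {d : ℕ} (w : List (Transition d)) (a b z : Config d) (h : Fire w a b) :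
    Fire w (a + z) (b + z) := by
  induction w generalizing a with
  | nil => simp only [Fire] at h ⊢; rw [h]
  | cons t w ih =>
    obtain ⟨c, ⟨q, h1, h2⟩, h3⟩ := h
    exact ⟨c + z, ⟨q + z, by rw [h1, add_assoc], by rw [h2, add_assoc]⟩, ih c h3⟩

theorem fire_append {d : ℕ} (w w' : List (Transition d)) (a b c : Config d) (h : Fire w a b)
    (h' : Fire w' b c) : Fire (w ++ w') a c := by
  induction w generalizing a with
  | nil => simp only [Fire] at h; subst h; exact h'
  | cons t w ih =>
    obtain ⟨e, h1, h3⟩ := h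
    exact ⟨e, h1, ih e h3⟩

theorem reachStar_add {d : ℕ} {T : Finset (Transition d)} {a b a' b' : Config d}
    (h : ReachStar T a b) (h' : ReachStar T a' b') : ReachStar T (a + a') (b + b') := by
  obtain ⟨w, hw, h⟩ := h
  obtain ⟨w', hw', h'⟩ := h'
  refine ⟨w ++ w', fun t ht => (List.mem_append.1 ht).elim (hw t) (hw' t), ?_⟩
  refine fire_append _ _ _ (b + a') _ (fire_add_right _ _ _ _ h) ?_
  rw [add_comm b a', add_comm b b']
  exact fire_add_right _ _ _ _ h'

theorem reachStar_outside {d : ℕ} {T : Finset (Transition d)}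
    (hM : MSet T = (T : Set (Transition d))) {a b : Config d} (h : ReachStar T a b)
    (i : Fin d) (hi : i ∉ Iboth T) : a i = b i := by
  obtain ⟨w, hw, h⟩ := h
  induction w generalizing a with
  | nil => simp only [Fire] at h; rw [h]
  | cons t w ih =>
    obtain ⟨c, ⟨q, h1, h2⟩, h3⟩ := h
    rw [← ih (fun s hs => hw s (List.mem_cons_of_mem _ hs)) h3]
    have ht : t ∈ MSet T := by
      rw [hM]; exact hw t List.mem_cons_self
    have hu : ¬ 0 < t.1 i := fun hp => hi (ht.2 (Or.inl hp))
    have hv : ¬ 0 < t.2 i := fun hp => hi (ht.2 (Or.inr hp))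
    rw [h1, h2]
    simp only [Pi.add_apply]
    omega

theorem exists_cover {d : ℕ} (P : Config d → Prop) (h0 : P 0)
    (hadd : ∀ a b, P a → P b → P (a + b)) (s : Finset (Fin d))
    (hs : ∀ i ∈ s, ∃ c, P c ∧ i ∈ pos c) : ∃ x, P x ∧ ∀ i ∈ s, i ∈ pos x := by
  induction s using Finset.induction_on with
  | empty => exact ⟨0, h0, by simp⟩
  | insert j s _ ih =>
    obtain ⟨x, hx, hxs⟩ := ih (fun i hi => hs i (Finset.mem_insert_of_mem hi))
    obtain ⟨c, hc, hcj⟩ := hs j (Finset.mem_insert_self _ _)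
    refine ⟨c + x, hadd _ _ hc hx, fun i hi => ?_⟩
    rcases Finset.mem_insert.1 hi with rfl | hi
    · exact Nat.add_pos_left hcj _
    · exact Nat.add_pos_right _ (hxs i hi)

/-- If every transition of `T` is mutually fireable, then there exist configurations `x, y`
with `pos x = I(T) = pos y`, `y →T* 0` and `0 →T* x`. -/
theorem exists_configs_of_all_mutuallyFireable {d : ℕ} (T : Finset (Transition d))
    (hM : MSet T = (T : Set (Transition d))) :
    ∃ x y : Config d, pos x = Iboth T ∧ pos y = Iboth T ∧
      ReachStar T y (0 : Config d) ∧ ReachStar T (0 : Config d) x := by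
  classical
  have hrefl : ReachStar T (0 : Config d) 0 := ⟨[], by simp, rfl⟩
  obtain ⟨x, hx, hxs⟩ := exists_cover (fun c => ReachStar T 0 c) hrefl
    (fun a b ha hb => by simpa using reachStar_add ha hb) (Set.toFinite (Iboth T)).toFinset
    (fun i hi => ((Set.Finite.mem_toFinset _).1 hi).1)
  obtain ⟨y, hy, hys⟩ := exists_cover (fun c => ReachStar T c 0) hrefl
    (fun a b ha hb => by simpa using reachStar_add ha hb) (Set.toFinite (Iboth T)).toFinset
    (fun i hi => ((Set.Finite.mem_toFinset _).1 hi).2)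
  refine ⟨x, y, Set.Subset.antisymm (fun i hi => ?_)
    (fun i hi => hxs i ((Set.Finite.mem_toFinset _).2 hi)),
    Set.Subset.antisymm (fun i hi => ?_)
    (fun i hi => hys i ((Set.Finite.mem_toFinset _).2 hi)), hy, hx⟩
  · by_contra hn
    have := reachStar_outside hM hx i hn
    simp only [pos, Set.mem_setOf_eq, Pi.zero_apply] at hi this
    omega
  · by_contra hn
    have := reachStar_outside hM hy i hn
    simp only [pos, Set.mem_setOf_eq, Pi.zero_apply] at hi this
    omega
end

section
/- For every Petri net T of dimension d there exists a function ψ : T → ℕ such that Σ_{t ∈ T} ψ(t)·Δ(t) = 0 and ψ(t) ≥ 1 for every ultimately cyclic transition t ∈ U(T). -/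
theorem fire_displacement {d : ℕ} (T : Finset (Transition d)) (w : List (Transition d)) :
    ∀ x y : Config d, (∀ s ∈ w, s ∈ T) → Fire w x y →
      ∀ i : Fin d, ∑ t ∈ T, ((w.count t : ℕ) : ℤ) * Delta t i = (y i : ℤ) - x i := by
  induction w with
  | nil =>
    intro x y _ h i
    have h' : x = y := h
    simp [h']
  | cons a w ih =>
    intro x y hT h i
    obtain ⟨c, ⟨z, hx, hc⟩, hf⟩ := h
    have h1 := ih c y (fun s hs => hT s (List.mem_cons_of_mem _ hs)) hf i
    have ha : a ∈ T := hT a List.mem_cons_self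
    have h2 : ∑ t ∈ T, (((a :: w).count t : ℕ) : ℤ) * Delta t i
        = ∑ t ∈ T, ((w.count t : ℕ) : ℤ) * Delta t i
          + ∑ t ∈ T, (if a = t then Delta t i else 0) := by
      rw [← Finset.sum_add_distrib]
      refine Finset.sum_congr rfl fun t _ => ?_
      by_cases hat : a = t
      · subst hat
        simp [add_mul]
      · simp [List.count_cons, hat]
    rw [h2, h1, Finset.sum_ite_eq, if_pos ha, hx, hc]
    simp only [Delta, Pi.add_apply]
    push_cast
    ring

theorem exists_nat_solution_positive_on_USet {d : ℕ} (T : Finset (Transition d)) :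
    ∃ ψ : Transition d → ℕ,
      (∀ i : Fin d, ∑ t ∈ T, (ψ t : ℤ) * Delta t i = 0) ∧
      ∀ t ∈ USet T, 1 ≤ ψ t := by
  have key : ∀ s : Transition d, ∃ f : Transition d → ℕ,
      (∀ i : Fin d, ∑ t ∈ T, (f t : ℤ) * Delta t i = 0) ∧ (s ∈ USet T → 1 ≤ f s) := by
    intro s
    by_cases hs : s ∈ USet T
    · obtain ⟨w, c, hw, hsw, hf⟩ := hs
      refine ⟨fun t => w.count t, fun i => ?_, fun _ => List.count_pos_iff.mpr hsw⟩
      rw [fire_displacement T w c c hw hf i, sub_self]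
    · exact ⟨fun _ => 0, by simp, fun h => absurd h hs⟩
  choose f hf0 hf1 using key
  refine ⟨fun t => ∑ s ∈ T, f s t, fun i => ?_, fun t ht => ?_⟩
  · push_cast
    simp_rw [Finset.sum_mul]
    rw [Finset.sum_comm]
    exact Finset.sum_eq_zero fun s _ => hf0 s i
  · have htT : t ∈ T := by
      obtain ⟨w, c, hw, hsw, _⟩ := ht
      exact hw t hsw
    exact (hf1 t ht).trans
      (Finset.single_le_sum (f := fun s => f s t) (fun _ _ => Nat.zero_le _) htT)
end

section
/- Let T be a Petri net of dimension d, let μ(T') = M(T') ∩ U(T') for Petri nets T' of dimension d, and define the sequence T₀ = T and T_{n+1} = μ(T_n) for n ≥ 0. Then the sequence is non-increasing, T_{n+1} = T_n for n = |T|, and Λ(T) = T_{|T|}. -/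
theorem fire_append_s13 {d : ℕ} {a b : List (Transition d)} {x z : Config d} :
    Fire (a ++ b) x z ↔ ∃ y, Fire a x y ∧ Fire b y z := by
  induction a generalizing x with
  | nil => simp [Fire]
  | cons t a ih =>
    simp only [List.cons_append, Fire, ih]
    constructor
    · rintro ⟨c, h, y, h1, h2⟩
      exact ⟨y, ⟨c, h, h1⟩, h2⟩
    · rintro ⟨y, ⟨c, h, h1⟩, h2⟩
      exact ⟨c, h, y, h1, h2⟩

theorem fire_add {d : ℕ} {a : List (Transition d)} {x y : Config d} (z : Config d)
    (h : Fire a x y) : Fire a (x + z) (y + z) := by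
  induction a generalizing x with
  | nil => simp only [Fire] at h ⊢; rw [h]
  | cons t a ih =>
    obtain ⟨c, ⟨z', h1, h2⟩, h3⟩ := h
    exact ⟨c + z, ⟨z' + z, by rw [h1, add_assoc], by rw [h2, add_assoc]⟩, ih h3⟩

theorem fire_sum {d : ℕ} {a : List (Transition d)} {x y : Config d}
    (h : Fire a x y) : x + (a.map Prod.snd).sum = y + (a.map Prod.fst).sum := by
  induction a generalizing x with
  | nil => simp only [Fire] at h; simp [h]
  | cons t a ih =>
    obtain ⟨c, ⟨z', h1, h2⟩, h3⟩ := h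
    have := ih h3
    subst h1 h2
    simp only [List.map_cons, List.sum_cons]
    funext i
    have := congrFun this i
    simp only [Pi.add_apply] at this ⊢
    omega

theorem fire_of_sum {d : ℕ} (a : List (Transition d)) (z : Config d) :
    Fire a ((a.map Prod.fst).sum + z) ((a.map Prod.snd).sum + z) := by
  induction a generalizing z with
  | nil => simp [Fire]
  | cons t a ih =>
    refine ⟨t.2 + ((a.map Prod.fst).sum + z), ⟨(a.map Prod.fst).sum + z, ?_, rfl⟩, ?_⟩
    · simp [add_assoc]
    · have := ih (t.2 + z)
      convert this using 1
      · abel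
      · simp only [List.map_cons, List.sum_cons]; abel

theorem reach_trans {d : ℕ} {T : Finset (Transition d)} {x y z : Config d}
    (h1 : ReachStar T x y) (h2 : ReachStar T y z) : ReachStar T x z := by
  obtain ⟨a, ha, ha'⟩ := h1
  obtain ⟨b, hb, hb'⟩ := h2
  refine ⟨a ++ b, ?_, fire_append_s13.2 ⟨y, ha', hb'⟩⟩
  intro t ht
  rcases List.mem_append.1 ht with h | h
  · exact ha t h
  · exact hb t h

theorem reach_add {d : ℕ} {T : Finset (Transition d)} {x y : Config d} (z : Config d)
    (h1 : ReachStar T x y) : ReachStar T (x + z) (y + z) := by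
  obtain ⟨a, ha, ha'⟩ := h1
  exact ⟨a, ha, fire_add z ha'⟩

theorem reach_add_zero_left {d : ℕ} {T : Finset (Transition d)} {x y : Config d}
    (h1 : ReachStar T 0 x) (h2 : ReachStar T 0 y) : ReachStar T 0 (x + y) := by
  have := reach_add y h1
  rw [zero_add] at this
  exact reach_trans h2 this

theorem reach_add_zero_right {d : ℕ} {T : Finset (Transition d)} {x y : Config d}
    (h1 : ReachStar T x 0) (h2 : ReachStar T y 0) : ReachStar T (x + y) 0 := by
  have := reach_add y h1
  rw [zero_add] at this
  exact reach_trans this h2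

theorem reach_nil {d : ℕ} (T : Finset (Transition d)) (x : Config d) : ReachStar T x x :=
  ⟨[], by simp, rfl⟩

theorem exists_plus {d : ℕ} (T : Finset (Transition d)) (S : Finset (Fin d)) :
    ∃ c, ReachStar T 0 c ∧ ∀ i ∈ S, i ∈ Iplus T → 0 < c i := by
  classical
  induction S using Finset.induction_on with
  | empty => exact ⟨0, reach_nil T 0, by simp⟩
  | insert j S hj ih =>
    obtain ⟨c, h1, h2⟩ := ih
    by_cases hji : j ∈ Iplus T
    · obtain ⟨e, he, hp⟩ := hji
      refine ⟨c + e, reach_add_zero_left h1 he, ?_⟩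
      intro i hi hI
      rcases Finset.mem_insert.1 hi with rfl | hi
      · exact Nat.add_pos_right _ hp
      · exact Nat.add_pos_left (h2 i hi hI) _
    · refine ⟨c, h1, ?_⟩
      intro i hi hI
      rcases Finset.mem_insert.1 hi with rfl | hi
      · exact absurd hI hji
      · exact h2 i hi hI

theorem exists_minus {d : ℕ} (T : Finset (Transition d)) (S : Finset (Fin d)) :
    ∃ c, ReachStar T c 0 ∧ ∀ i ∈ S, i ∈ Iminus T → 0 < c i := by
  classical
  induction S using Finset.induction_on with
  | empty => exact ⟨0, reach_nil T 0, by simp⟩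
  | insert j S hj ih =>
    obtain ⟨c, h1, h2⟩ := ih
    by_cases hji : j ∈ Iminus T
    · obtain ⟨e, he, hp⟩ := hji
      refine ⟨c + e, reach_add_zero_right h1 he, ?_⟩
      intro i hi hI
      rcases Finset.mem_insert.1 hi with rfl | hi
      · exact Nat.add_pos_right _ hp
      · exact Nat.add_pos_left (h2 i hi hI) _
    · refine ⟨c, h1, ?_⟩
      intro i hi hI
      rcases Finset.mem_insert.1 hi with rfl | hi
      · exact absurd hI hji
      · exact h2 i hi hI

theorem exists_sigma {d : ℕ} (T : Finset (Transition d)) (S : Finset (Transition d))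
    (hS : ∀ t ∈ S, t ∈ USet T) :
    ∃ w : Multiset (Transition d), (∀ t ∈ w, t ∈ T) ∧ (∀ t ∈ S, t ∈ w) ∧
      (w.map Prod.fst).sum = (w.map Prod.snd).sum := by
  classical
  induction S using Finset.induction_on with
  | empty => exact ⟨0, by simp, by simp, by simp⟩
  | insert j S hj ih =>
    obtain ⟨w, h1, h2, h3⟩ := ih fun t ht => hS t (Finset.mem_insert_of_mem ht)
    obtain ⟨v, c, hv1, hv2, hv3⟩ := hS j (Finset.mem_insert_self _ _)
    have h4 := add_left_cancel (fire_sum hv3)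
    refine ⟨w + (v : Multiset _), ?_, ?_, ?_⟩
    · intro t ht
      rcases Multiset.mem_add.1 ht with h | h
      · exact h1 t h
      · exact hv1 t (by simpa using h)
    · intro t ht
      rcases Finset.mem_insert.1 ht with rfl | h
      · exact Multiset.mem_add.2 (Or.inr (by simpa using hv2))
      · exact Multiset.mem_add.2 (Or.inl (h2 t h))
    · simp [h3, h4]

/-- the word `τ` in the pumping argument -/
theorem exists_tau {d : ℕ} (T : Finset (Transition d)) (hS : ∀ t ∈ T, t ∈ USet T)
    {c c' : Config d} (hc : ReachStar T 0 c) (hc' : ReachStar T c' 0) :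
    ∃ w : List (Transition d), (∀ t ∈ w, t ∈ T) ∧ (∀ t ∈ T, t ∈ w) ∧
      (w.map Prod.fst).sum + c' = (w.map Prod.snd).sum + c := by
  classical
  obtain ⟨σ, h1, h2, h3⟩ := exists_sigma T T hS
  obtain ⟨u, hu, hu'⟩ := hc
  obtain ⟨v, hv, hv'⟩ := hc'
  have su := fire_sum hu'
  have sv := fire_sum hv'
  have hcnt : ∀ t ∈ T, 1 ≤ σ.count t := fun t ht => Multiset.one_le_count_iff_mem.2 (h2 t ht)
  set uv : Multiset (Transition d) := (u : Multiset _) + (v : Multiset _) with huv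
  clear_value uv
  have huvT : ∀ t ∈ uv, t ∈ T := by
    intro t ht
    rw [huv] at ht
    rcases Multiset.mem_add.1 ht with h | h
    · exact hu t (by simpa using h)
    · exact hv t (by simpa using h)
  have hlt : ∀ t ∈ T, uv.count t < ((uv.card + 1) • σ).count t := by
    intro t ht
    rw [Multiset.count_nsmul]
    have := Multiset.count_le_card t uv
    have := hcnt t ht
    nlinarith
  have hle : uv ≤ (uv.card + 1) • σ := by
    rw [Multiset.le_iff_count]
    intro t
    by_cases ht : t ∈ T
    · exact (hlt t ht).le
    · rw [Multiset.count_eq_zero_of_notMem fun h => ht (huvT t h)]; exact Nat.zero_le _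
  obtain ⟨τ, hτ⟩ := Multiset.le_iff_exists_add.1 hle
  have hsum : (((uv.card + 1) • σ).map Prod.fst).sum = (((uv.card + 1) • σ).map Prod.snd).sum := by
    rw [Multiset.map_nsmul, Multiset.map_nsmul, Multiset.sum_nsmul, Multiset.sum_nsmul, h3]
  rw [hτ, huv] at hsum
  obtain ⟨w, rfl⟩ : ∃ w : List (Transition d), τ = (w : Multiset (Transition d)) :=
    ⟨τ.toList, (Multiset.coe_toList τ).symm⟩
  refine ⟨w, ?_, ?_, ?_⟩
  · intro t ht
    have : t ∈ (uv.card + 1) • σ := by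
      rw [hτ]; exact Multiset.mem_add.2 (Or.inr (by simpa using ht))
    exact h1 t (Multiset.mem_of_mem_nsmul this)
  · intro t ht
    have := hlt t ht
    rw [hτ, Multiset.count_add] at this
    have h5 : 0 < Multiset.count t (w : Multiset _) := by
      omega
    simpa using Multiset.count_pos.1 h5
  · simp only [Multiset.map_add, Multiset.map_coe, Multiset.sum_add,
      Multiset.sum_coe] at hsum
    funext i
    have e1 := congrFun hsum i
    have e2 := congrFun su i
    have e3 := congrFun sv i
    simp only [Pi.add_apply, Pi.zero_apply] at e1 e2 e3 ⊢
    omega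

theorem reach_nsmul_left {d : ℕ} {T : Finset (Transition d)} {x : Config d}
    (h : ReachStar T 0 x) (n : ℕ) : ReachStar T 0 (n • x) := by
  induction n with
  | zero => simpa using reach_nil T 0
  | succ n ih => rw [succ_nsmul]; exact reach_add_zero_left ih h

theorem reach_nsmul_right {d : ℕ} {T : Finset (Transition d)} {x : Config d}
    (h : ReachStar T x 0) (n : ℕ) : ReachStar T (n • x) 0 := by
  induction n with
  | zero => simpa using reach_nil T 0
  | succ n ih => rw [succ_nsmul]; exact reach_add_zero_right ih h

theorem pump {d : ℕ} {P Q c c' : Config d} {w : List (Transition d)}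
    (hw : ∀ z, Fire w (P + z) (Q + z)) (hPQ : P + c' = Q + c) (n : ℕ)
    (hn : ∀ i, P i ≤ n) (hc : ∀ i, 0 < P i → 0 < c i) (hc' : ∀ i, 0 < P i → 0 < c' i)
    (a b : ℕ) (hab : a + 1 + b = n) :
    Fire w ((a + 1) • c + b • c') (a • c + (b + 1) • c') := by
  have hle : P ≤ (a + 1) • c + b • c' := by
    intro i
    rcases Nat.eq_zero_or_pos (P i) with h | h
    · rw [h]; exact Nat.zero_le _
    · have h1 := hc i h
      have h2 := hc' i h
      have h3 := hn i
      simp only [Pi.add_apply, Pi.smul_apply, smul_eq_mul]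
      nlinarith
  obtain ⟨z, hz⟩ := le_iff_exists_add.1 hle
  have := hw z
  rw [← hz] at this
  convert this using 1
  funext i
  have e1 := congrFun hz i
  have e2 := congrFun hPQ i
  simp only [Pi.add_apply, Pi.smul_apply, smul_eq_mul, add_mul, one_mul] at e1 e2 ⊢
  omega

theorem lambda_of_fixed {d : ℕ} (T : Finset (Transition d)) (hM : ∀ t ∈ T, t ∈ MSet T)
    (hU : ∀ t ∈ T, t ∈ USet T) (t : Transition d) (ht : t ∈ T) : t ∈ LambdaSet T := by
  classical
  obtain ⟨c, hc, hcp⟩ := exists_plus T Finset.univ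
  obtain ⟨c', hc', hcp'⟩ := exists_minus T Finset.univ
  obtain ⟨w, hwT, hTw, hPQ⟩ := exists_tau T hU hc hc'
  have hfire := fire_of_sum w
  have hsupp : ∀ w : List (Transition d), (∀ t ∈ w, t ∈ T) →
      ∀ i, 0 < (w.map Prod.fst).sum i → i ∈ Iboth T := by
    intro w
    induction w with
    | nil => intro _ i hi; simp at hi
    | cons s w ih =>
      intro hs i hi
      simp only [List.map_cons, List.sum_cons, Pi.add_apply] at hi
      rcases Nat.eq_zero_or_pos (s.1 i) with h | h
      · exact ih (fun t ht => hs t (List.mem_cons_of_mem _ ht)) i (by omega)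
      · exact (hM s (hs s List.mem_cons_self)).2 (Or.inl h)
  have hsupp := hsupp w hwT
  set P := (w.map Prod.fst).sum with hP
  set Q := (w.map Prod.snd).sum with hQ
  have hp : ∀ i, 0 < P i → 0 < c i := fun i hi => hcp i (Finset.mem_univ _) (hsupp i hi).1
  have hp' : ∀ i, 0 < P i → 0 < c' i := fun i hi => hcp' i (Finset.mem_univ _) (hsupp i hi).2
  obtain ⟨N, hN⟩ : ∃ N, N = ∑ i, P i := ⟨_, rfl⟩
  have hn : ∀ i, P i ≤ N + 1 := fun i => by
    have := Finset.single_le_sum (f := P) (fun j _ => Nat.zero_le _) (Finset.mem_univ i)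
    omega
  have hstep := pump hfire hPQ (N + 1) hn hp hp'
  have hit : ∀ b a, a + b = N → ReachStar T ((N + 1) • c) ((a + 1) • c + b • c') := by
    intro b
    induction b with
    | zero => intro a h; obtain rfl : a = N := h; simpa using reach_nil T _
    | succ b ih =>
      intro a h
      exact reach_trans (ih (a + 1) (by omega)) ⟨w, hwT, hstep (a + 1) b (by omega)⟩
  have h1 := reach_trans (reach_nsmul_left hc (N + 1)) (hit N 0 (by omega))
  have h2 := hstep 0 N (by omega)
  rw [zero_nsmul, zero_add ((N + 1) • c')] at h2
  obtain ⟨x, hx, hx'⟩ := h1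
  obtain ⟨y, hy, hy'⟩ := reach_nsmul_right hc' (N + 1)
  refine ⟨x ++ (w ++ y), ?_, ?_, fire_append_s13.2 ⟨_, hx', fire_append_s13.2 ⟨_, h2, hy'⟩⟩⟩
  · intro s hs
    simp only [List.mem_append] at hs
    rcases hs with h | h | h
    · exact hx s h
    · exact hwT s h
    · exact hy s h
  · simp [hTw t ht]

theorem mu_of_cycle {d : ℕ} (T : Finset (Transition d)) (w : List (Transition d))
    (hw : ∀ s ∈ w, s ∈ T) (hf : Fire w (0 : Config d) 0) (t : Transition d) (ht : t ∈ w) :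
    t ∈ MSet T ∩ USet T := by
  refine ⟨⟨hw t ht, ?_⟩, w, 0, hw, ht, hf⟩
  obtain ⟨a, b, rfl⟩ := List.append_of_mem ht
  obtain ⟨x, hx, y, ⟨z, h1, h2⟩, hy⟩ := fire_append_s13.1 hf
  have ra : ReachStar T 0 x := ⟨a, fun s hs => hw s (by simp [hs]), hx⟩
  have rt : ReachStar T x y := ⟨[t], by simpa using hw t ht, y, ⟨z, h1, h2⟩, rfl⟩
  have rb : ReachStar T y 0 := ⟨b, fun s hs => hw s (by simp [hs]), hy⟩
  rintro i (hi | hi)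
  · have : i ∈ pos x := by rw [h1]; exact Nat.add_pos_left hi _
    exact ⟨⟨x, ra, this⟩, ⟨x, reach_trans rt rb, this⟩⟩
  · have : i ∈ pos y := by rw [h2]; exact Nat.add_pos_left hi _
    exact ⟨⟨y, reach_trans ra rt, this⟩, ⟨y, rb, this⟩⟩

/-- Iterating `μ(T') = M(T') ∩ U(T')` from `T` yields a non-increasing sequence that
stabilizes at step `|T|` with value `Λ(T)`. -/
theorem lambda_eq_iterate_mu {d : ℕ} (T : Finset (Transition d))
    (Ts : ℕ → Finset (Transition d)) (h0 : Ts 0 = T)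
    (hrec : ∀ n : ℕ, (Ts (n + 1) : Set (Transition d)) = MSet (Ts n) ∩ USet (Ts n)) :
    (∀ n : ℕ, Ts (n + 1) ⊆ Ts n) ∧
      Ts (T.card + 1) = Ts T.card ∧
      LambdaSet T = (Ts T.card : Set (Transition d)) := by
  have hmem : ∀ n t, t ∈ Ts (n + 1) ↔ t ∈ MSet (Ts n) ∩ USet (Ts n) := by
    intro n t
    rw [← hrec n, Finset.mem_coe]
  have hdec : ∀ n, Ts (n + 1) ⊆ Ts n := fun n t ht => ((hmem n t).1 ht).1.1
  have hcard : ∀ n, Ts (n + 1) = Ts n ∨ (Ts (n + 1)).card + n + 1 ≤ T.card := by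
    intro n
    induction n with
    | zero =>
      by_cases h : Ts (0 + 1) = Ts 0
      · exact Or.inl h
      · have := Finset.card_lt_card ((hdec 0).ssubset_of_ne h)
        rw [h0] at this
        right; omega
    | succ n ih =>
      rcases ih with ih | ih
      · left
        ext t
        rw [hmem (n + 1), hmem n, ih]
      · by_cases h : Ts (n + 1 + 1) = Ts (n + 1)
        · exact Or.inl h
        · have := Finset.card_lt_card ((hdec (n + 1)).ssubset_of_ne h)
          right; omega
  have hfix : Ts (T.card + 1) = Ts T.card := by
    rcases hcard T.card with h | h
    · exact h
    · omega
  have hsub : ∀ n, Ts n ⊆ T := by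
    intro n
    induction n with
    | zero => rw [h0]
    | succ n ih => exact (hdec n).trans ih
  refine ⟨hdec, hfix, Set.Subset.antisymm ?_ ?_⟩
  · rintro t ⟨w, hw, ht, hf⟩
    have : ∀ n, ∀ s ∈ w, s ∈ Ts n := by
      intro n
      induction n with
      | zero => rw [h0]; exact hw
      | succ n ih => exact fun s hs => (hmem n s).2 (mu_of_cycle _ w ih hf s hs)
    exact this _ t ht
  · intro t ht
    have hmu : ∀ s ∈ Ts T.card, s ∈ MSet (Ts T.card) ∩ USet (Ts T.card) := by
      intro s hs
      rw [← hfix] at hs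
      exact (hmem _ s).1 hs
    obtain ⟨w, hw, h1, h2⟩ := lambda_of_fixed (Ts T.card) (fun s hs => (hmu s hs).1)
      (fun s hs => (hmu s hs).2) t ht
    exact ⟨w, fun s hs => hsub _ (hw s hs), h1, h2⟩
end
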